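/- arXiv:2402.07823 — 4 statements merged into one kernel-verified Lean document; each statement's English description precedes it below -/
import Mathlib

section
/- For every L ≥ 1, the minimum Hamming weight of a nonzero vector in the GF(2) row space of H_L (the span over GF(2) of the rows of H_L) equals L + 1 if L is odd, and equals L if L is even (with L ≥ 2 in the even case). -/
/-- The permutation `P_{M+1}` (paper index `M+1`) of the `2^(M+1)` columns,
exchanging the two members of each consecutive pair (0-indexed: `2k ↔ 2k+1`). -/
def pairSwap (M : ℕ) : Fin (2 ^ (M + 1)) → Fin (2 ^ (M + 1)) := fun c =>
  if _h : c.val % 2 = 0 then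
    ⟨c.val + 1, by
      have hc := c.isLt
      have h2 : (2:ℕ) ^ (M + 1) = 2 * 2 ^ M := by ring
      omega⟩
  else
    ⟨c.val - 1, by have hc := c.isLt; omega⟩

/-- `Hmat L` is the parity-check matrix `H_{L+1}` of the paper (paper index shifted by one),
a `2^L × 2^(L+1)` matrix over GF(2), defined recursively.  Rows and columns are 0-indexed:
0-indexed row `r` is paper row `r+1`, 0-indexed column `c` is paper column `c+1`. -/
def Hmat : (L : ℕ) → Matrix (Fin (2 ^ L)) (Fin (2 ^ (L + 1))) (ZMod 2)
  | 0 => Matrix.of fun _ _ => 1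
  | (L + 1) => Matrix.of fun r c =>
    have hr : r.val / 2 < 2 ^ L := by
      have h := r.isLt
      have h2 : (2:ℕ) ^ (L + 1) = 2 * 2 ^ L := by ring
      omega
    have hc : c.val / 2 < 2 ^ (L + 1) := by
      have h := c.isLt
      have h2 : (2:ℕ) ^ (L + 1 + 1) = 2 * 2 ^ (L + 1) := by ring
      omega
    if c.val % 2 = 1 then (if c.val = 2 * r.val + 1 then 1 else 0)
    else if r.val % 2 = 1 then Hmat L ⟨r.val / 2, hr⟩ (pairSwap L ⟨c.val / 2, hc⟩)
    else Hmat L ⟨r.val / 2, hr⟩ ⟨c.val / 2, hc⟩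

/-- The Hamming weight of a vector over GF(2): the number of nonzero coordinates. -/
def hamWt {n : ℕ} (v : Fin n → ZMod 2) : ℕ :=
  (Finset.univ.filter (fun c => v c ≠ 0)).card

open Finset

/-- The even-indexed part of a sequence, as a linear map. -/
def evenPart : (ℕ → ZMod 2) →ₗ[ZMod 2] (ℕ → ZMod 2) :=
  LinearMap.funLeft (ZMod 2) (ZMod 2) fun k => 2 * k

/-- The odd-indexed part of a sequence, as a linear map. -/
def oddPart : (ℕ → ZMod 2) →ₗ[ZMod 2] (ℕ → ZMod 2) :=
  LinearMap.funLeft (ZMod 2) (ZMod 2) fun k => 2 * k + 1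

@[simp] lemma evenPart_apply (x : ℕ → ZMod 2) (k : ℕ) : evenPart x k = x (2 * k) := rfl

@[simp] lemma oddPart_apply (x : ℕ → ZMod 2) (k : ℕ) : oddPart x k = x (2 * k + 1) := rfl

/-- The interleaving of two sequences, as a linear map. -/
def interleave : (ℕ → ZMod 2) × (ℕ → ZMod 2) →ₗ[ZMod 2] (ℕ → ZMod 2) where
  toFun p k := if k % 2 = 0 then p.1 (k / 2) else p.2 (k / 2)
  map_add' p q := by ext k; simp only [Prod.fst_add, Prod.snd_add, Pi.add_apply]; split_ifs <;> rfl
  map_smul' a p := by ext k; simp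

lemma interleave_apply (p : (ℕ → ZMod 2) × (ℕ → ZMod 2)) (k : ℕ) :
    interleave p k = if k % 2 = 0 then p.1 (k / 2) else p.2 (k / 2) := rfl

@[simp] lemma evenPart_interleave (p : (ℕ → ZMod 2) × (ℕ → ZMod 2)) :
    evenPart (interleave p) = p.1 := by
  ext k; simp [interleave_apply]

@[simp] lemma oddPart_interleave (p : (ℕ → ZMod 2) × (ℕ → ZMod 2)) :
    oddPart (interleave p) = p.2 := by
  ext k
  have h : (2 * k + 1) / 2 = k := by omega
  simp [interleave_apply, Nat.add_mod, h]

@[simp] lemma interleave_parts (x : ℕ → ZMod 2) : interleave (evenPart x, oddPart x) = x := by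
  ext k
  rw [interleave_apply]
  split_ifs with h
  · exact congrArg x (show 2 * (k / 2) = k by omega)
  · exact congrArg x (show 2 * (k / 2) + 1 = k by omega)

/-- The sum of the identity and the adjacency operator of the `n`-dimensional hypercube, acting on
sequences through the `n` lowest bits of the index. -/
def cubeOp : ℕ → (ℕ → ZMod 2) →ₗ[ZMod 2] (ℕ → ZMod 2)
  | 0 => LinearMap.id
  | n + 1 => interleave ∘ₗ
      (cubeOp n ∘ₗ evenPart + oddPart).prod (cubeOp n ∘ₗ oddPart + evenPart)

lemma cubeOp_succ (n : ℕ) (x : ℕ → ZMod 2) :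
    cubeOp (n + 1) x = interleave
      (cubeOp n (evenPart x) + oddPart x, cubeOp n (oddPart x) + evenPart x) := rfl

/-- The number of nonzero entries among the first `2 ^ n` entries of a sequence. -/
def cubeWt : ℕ → (ℕ → ZMod 2) → ℕ
  | 0, x => if x 0 = 0 then 0 else 1
  | n + 1, x => cubeWt n (evenPart x) + cubeWt n (oddPart x)

@[simp] lemma cubeWt_zero_right (n : ℕ) : cubeWt n 0 = 0 := by
  induction n with
  | zero => simp [cubeWt]
  | succ n ih => simp [cubeWt, ih]

lemma cubeWt_add_le (n : ℕ) (x y : ℕ → ZMod 2) : cubeWt n (x + y) ≤ cubeWt n x + cubeWt n y := by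
  induction n generalizing x y with
  | zero =>
    simp only [cubeWt, Pi.add_apply]
    have key : ∀ a b : ZMod 2, (if a + b = 0 then 0 else 1) ≤
        (if a = 0 then 0 else 1) + (if b = 0 then 0 else 1) := by decide
    exact key _ _
  | succ n ih =>
    have h₁ := ih (evenPart x) (evenPart y)
    have h₂ := ih (oddPart x) (oddPart y)
    simp only [cubeWt, map_add]
    omega

lemma cast_cubeWt_add (n : ℕ) (x y : ℕ → ZMod 2) :
    (cubeWt n (x + y) : ZMod 2) = cubeWt n x + cubeWt n y := by
  induction n generalizing x y with
  | zero =>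
    simp only [cubeWt, Pi.add_apply]
    have key : ∀ a b : ZMod 2, (((if a + b = 0 then 0 else 1 : ℕ)) : ZMod 2) =
        ((if a = 0 then 0 else 1 : ℕ) : ZMod 2) + ((if b = 0 then 0 else 1 : ℕ) : ZMod 2) := by
      decide
    exact key _ _
  | succ n ih =>
    simp only [cubeWt, map_add, Nat.cast_add, ih]
    ring

lemma cast_cubeWt_cubeOp (n : ℕ) (x : ℕ → ZMod 2) :
    (cubeWt n (cubeOp n x) : ZMod 2) = (n + 1) * cubeWt n x := by
  induction n generalizing x with
  | zero => simp [cubeOp]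
  | succ n ih =>
    simp only [cubeWt, cubeOp_succ, evenPart_interleave, oddPart_interleave, cast_cubeWt_add, ih,
      Nat.cast_add, Nat.cast_one]
    ring

lemma cubeOp_cubeOp (n : ℕ) (x : ℕ → ZMod 2) :
    cubeOp n (cubeOp n x) = ((n : ZMod 2) + 1) • x := by
  induction n generalizing x with
  | zero => simp [cubeOp]
  | succ n ih =>
    have key (u v : ℕ → ZMod 2) : cubeOp n (cubeOp n u + v) + (cubeOp n v + u) =
        (((n + 1 : ℕ) : ZMod 2) + 1) • u := by
      have h := CharTwo.add_self_eq_zero (cubeOp n v)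
      rw [map_add, ih, add_assoc, ← add_assoc (cubeOp n v), h, zero_add, Nat.cast_succ,
        add_smul ((n : ZMod 2) + 1) 1 u, one_smul]
    rw [cubeOp_succ, cubeOp_succ, evenPart_interleave, oddPart_interleave, key, key]
    simp only [← Prod.smul_mk, map_smul, interleave_parts]

lemma cubeWt_cubeOp_eq_zero {n : ℕ} {x : ℕ → ZMod 2} (h : cubeWt n x = 0) :
    cubeWt n (cubeOp n x) = 0 := by
  induction n generalizing x with
  | zero => simpa [cubeOp] using h
  | succ n ih =>
    simp only [cubeWt, Nat.add_eq_zero_iff] at h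
    have h₁ := cubeWt_add_le n (cubeOp n (evenPart x)) (oddPart x)
    have h₂ := cubeWt_add_le n (cubeOp n (oddPart x)) (evenPart x)
    rw [ih h.1] at h₁
    rw [ih h.2] at h₂
    simp only [cubeWt, cubeOp_succ, evenPart_interleave, oddPart_interleave]
    omega

lemma cubeWt_le_add_left (n : ℕ) (x y : ℕ → ZMod 2) :
    cubeWt n x ≤ cubeWt n (x + y) + cubeWt n y := by
  have h := cubeWt_add_le n (x + y) y
  rwa [add_assoc, CharTwo.add_self_eq_zero, add_zero] at h

/-- If the square of `cubeOp n` vanishes, `y = cubeOp n z` and `z = cubeOp n y` force `z = 0`. -/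
lemma cubeWt_eq_zero_of_cubeOp_swap {n : ℕ} (hn : ((n : ZMod 2) + 1) = 0) {y z : ℕ → ZMod 2}
    (hy : cubeWt n (cubeOp n z + y) = 0) (hz : cubeWt n (cubeOp n y + z) = 0) :
    cubeWt n z = 0 := by
  have h₁ := cubeWt_cubeOp_eq_zero hy
  rw [map_add, cubeOp_cubeOp, hn, zero_smul, zero_add] at h₁
  have h₂ := cubeWt_le_add_left n z (cubeOp n y)
  rw [add_comm z] at h₂
  omega

lemma add_one_le_cubeWt_add_cubeWt_cubeOp (n : ℕ) (x : ℕ → ZMod 2) (hx : cubeWt n x ≠ 0) :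
    (if Even n then n + 2 else n + 1) ≤ cubeWt n x + cubeWt n (cubeOp n x) := by
  induction n generalizing x with
  | zero => simp [cubeOp]; omega
  | succ n ih =>
    set y := evenPart x
    set z := oddPart x
    have hwx : cubeWt (n + 1) x = cubeWt n y + cubeWt n z := rfl
    have hw : cubeWt (n + 1) (cubeOp (n + 1) x) =
        cubeWt n (cubeOp n y + z) + cubeWt n (cubeOp n z + y) := by
      simp [cubeWt, cubeOp_succ, y, z]
    have hy := ih y
    have hz := ih z
    have h₁ := cubeWt_le_add_left n (cubeOp n y) z
    have h₂ := cubeWt_le_add_left n (cubeOp n z) y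
    rcases Nat.even_or_odd n with hn | hn
    · have hn' : ¬ Even (n + 1) := by simpa [Nat.even_add_one] using hn
      simp only [hn, hn', if_true, if_false] at hy hz ⊢
      omega
    · have hn' : Even (n + 1) := hn.add_one
      have hne : ¬ Even n := Nat.not_even_iff_odd.2 hn
      simp only [hne, hn', if_true, if_false] at hy hz ⊢
      have hn0 : (n : ZMod 2) + 1 = 0 := by
        have := (ZMod.natCast_eq_zero_iff_even).2 hn'
        simpa using this
      have hpar : Even (cubeWt (n + 1) x + cubeWt (n + 1) (cubeOp (n + 1) x)) := by
        rw [← ZMod.natCast_eq_zero_iff_even, Nat.cast_add, cast_cubeWt_cubeOp, Nat.cast_succ, hn0,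
          zero_add, one_mul, CharTwo.add_self_eq_zero]
      have hswap : cubeWt n (cubeOp n z + y) = 0 → cubeWt n (cubeOp n y + z) = 0 →
          cubeWt n z = 0 := cubeWt_eq_zero_of_cubeOp_swap hn0
      -- the bound `n + 2` suffices, because the left-hand side is even and `n` is odd
      have hlow : n + 2 ≤ cubeWt (n + 1) x + cubeWt (n + 1) (cubeOp (n + 1) x) := by
        have h₃ := cubeWt_le_add_left n y (cubeOp n z)
        have h₄ := cubeWt_le_add_left n z (cubeOp n y)
        rw [add_comm y] at h₃
        rw [add_comm z] at h₄
        have h₅ : cubeWt n z = 0 → cubeWt n (cubeOp n z) = 0 := cubeWt_cubeOp_eq_zero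
        have h₆ : cubeWt n y = 0 → cubeWt n (cubeOp n y) = 0 := cubeWt_cubeOp_eq_zero
        omega
      obtain ⟨a, ha⟩ := hpar
      obtain ⟨b, hb⟩ := hn
      omega

/-- The codeword with message `x`: the entries of `x` at odd indices (counting from zero), and
those of `cubeOp n x` at even indices. -/
def codeword (n : ℕ) : (ℕ → ZMod 2) →ₗ[ZMod 2] (ℕ → ZMod 2) :=
  interleave ∘ₗ (cubeOp n).prod LinearMap.id

lemma codeword_apply (n : ℕ) (x : ℕ → ZMod 2) (k : ℕ) :
    codeword n x k = if k % 2 = 0 then cubeOp n x (k / 2) else x (k / 2) := rfl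

lemma cubeWt_codeword (n : ℕ) (x : ℕ → ZMod 2) :
    cubeWt (n + 1) (codeword n x) = cubeWt n x + cubeWt n (cubeOp n x) := by
  simp [cubeWt, codeword, add_comm]

lemma sum_range_two_mul {M : Type*} [AddCommMonoid M] (f : ℕ → M) (m : ℕ) :
    ∑ i ∈ range (2 * m), f i = ∑ i ∈ range m, f (2 * i) + ∑ i ∈ range m, f (2 * i + 1) := by
  induction m with
  | zero => simp
  | succ m ih =>
    rw [show 2 * (m + 1) = 2 * m + 1 + 1 by ring]
    simp only [sum_range_succ, ih]
    abel

lemma sum_range_eq_cubeWt (n : ℕ) (x : ℕ → ZMod 2) :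
    ∑ i ∈ range (2 ^ n), (if x i ≠ 0 then 1 else 0) = cubeWt n x := by
  induction n generalizing x with
  | zero => simp [cubeWt]
  | succ n ih =>
    rw [pow_succ', sum_range_two_mul, cubeWt, ← ih, ← ih]
    rfl

lemma hamWt_eq_cubeWt (n : ℕ) (x : ℕ → ZMod 2) :
    hamWt (fun i : Fin (2 ^ n) => x i) = cubeWt n x := by
  rw [hamWt, card_filter, Fin.sum_univ_eq_sum_range fun i => if x i ≠ 0 then 1 else 0,
    sum_range_eq_cubeWt]

lemma evenPart_single (r : ℕ) :
    evenPart (Pi.single r 1) = if r % 2 = 0 then Pi.single (r / 2) 1 else 0 := by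
  ext k
  split_ifs <;> simp only [evenPart_apply, Pi.single_apply, Pi.zero_apply] <;> grind

lemma oddPart_single (r : ℕ) :
    oddPart (Pi.single r 1) = if r % 2 = 0 then 0 else Pi.single (r / 2) 1 := by
  ext k
  split_ifs <;> simp only [oddPart_apply, Pi.single_apply, Pi.zero_apply] <;> grind

lemma Hmat_eq_codeword (n : ℕ) (r : Fin (2 ^ n)) (c : Fin (2 ^ (n + 1))) :
    Hmat n r c = codeword n (Pi.single (r : ℕ) 1) c := by
  induction n with
  | zero =>
    have hc : (c : ℕ) / 2 = 0 := by have := c.isLt; omega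
    simp [Hmat, codeword_apply, cubeOp, hc]
  | succ n ih =>
    rw [codeword_apply, cubeOp_succ, interleave_apply, evenPart_single, oddPart_single]
    simp only [Hmat, Matrix.of_apply, ih, codeword_apply, pairSwap]
    have hc := c.isLt
    rcases Nat.mod_two_eq_zero_or_one c with h | h
    · rcases Nat.mod_two_eq_zero_or_one r with h' | h'
      · simp [h, h']
      · rcases Nat.mod_two_eq_zero_or_one (c / 2 : ℕ) with h'' | h''
        · have h₁ : ((c : ℕ) / 2 + 1) / 2 = c / 2 / 2 := by omega
          simp [h, h', h'', Nat.add_mod, h₁]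
        · have h₁ : ((c : ℕ) / 2 - 1) / 2 = c / 2 / 2 := by omega
          have h₂ : ((c : ℕ) / 2 - 1) % 2 = 0 := by omega
          simp [h, h', h'', h₁, h₂]
    · simp only [h, Pi.single_apply]
      grind

lemma cubeOp_apply_congr {n : ℕ} {x y : ℕ → ZMod 2} (h : ∀ k < 2 ^ n, x k = y k) :
    ∀ k < 2 ^ n, cubeOp n x k = cubeOp n y k := by
  induction n generalizing x y with
  | zero => exact h
  | succ n ih =>
    intro k hk
    rw [pow_succ'] at h hk
    have he : ∀ j < 2 ^ n, evenPart x j = evenPart y j := fun j hj =>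
      h _ (show 2 * j < 2 * 2 ^ n by omega)
    have ho : ∀ j < 2 ^ n, oddPart x j = oddPart y j := fun j hj =>
      h _ (show 2 * j + 1 < 2 * 2 ^ n by omega)
    have hk' : k / 2 < 2 ^ n := by omega
    simp only [cubeOp_succ, interleave_apply, Pi.add_apply, ih he _ hk', ih ho _ hk', he _ hk',
      ho _ hk']

lemma sum_smul_Hmat (n : ℕ) (x : ℕ → ZMod 2) :
    ∑ r : Fin (2 ^ n), x r • Hmat n r = fun c : Fin (2 ^ (n + 1)) => codeword n x c := by
  have hx : ∀ k < 2 ^ n, (∑ r : Fin (2 ^ n), x r • Pi.single (r : ℕ) (1 : ZMod 2)) k = x k := by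
    intro k hk
    rw [Fin.sum_univ_eq_sum_range fun i => x i • (Pi.single i 1 : ℕ → ZMod 2)]
    simp [Finset.sum_apply, Pi.single_apply, hk]
  ext c
  have hc : (c : ℕ) / 2 < 2 ^ n := by
    have := c.isLt
    have := pow_succ' 2 n
    omega
  calc (∑ r : Fin (2 ^ n), x r • Hmat n r) c
      = codeword n (∑ r : Fin (2 ^ n), x r • Pi.single (r : ℕ) (1 : ZMod 2)) c := by
        simp only [map_sum, map_smul, Finset.sum_apply, Pi.smul_apply, Hmat_eq_codeword]
    _ = codeword n x c := by
        rw [codeword_apply, codeword_apply, hx _ hc, cubeOp_apply_congr hx _ hc]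

lemma mem_span_Hmat_iff (n : ℕ) (v : Fin (2 ^ (n + 1)) → ZMod 2) :
    v ∈ Submodule.span (ZMod 2) (Set.range (Hmat n)) ↔
      ∃ x : ℕ → ZMod 2, (fun c : Fin (2 ^ (n + 1)) => codeword n x c) = v := by
  refine (Submodule.mem_span_range_iff_exists_fun (v := fun r => Hmat n r) (ZMod 2)).trans ?_
  constructor
  · rintro ⟨a, rfl⟩
    refine ⟨fun k => if h : k < 2 ^ n then a ⟨k, h⟩ else 0, ?_⟩
    rw [← sum_smul_Hmat]
    simp
  · rintro ⟨x, rfl⟩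
    exact ⟨fun r => x r, sum_smul_Hmat n x⟩

lemma cubeWt_single_zero (n : ℕ) : cubeWt n (Pi.single 0 1) = 1 := by
  induction n with
  | zero => simp [cubeWt]
  | succ n ih => simp [cubeWt, evenPart_single, oddPart_single, ih]

lemma cubeWt_cubeOp_single_zero (n : ℕ) : cubeWt n (cubeOp n (Pi.single 0 1)) = n + 1 := by
  induction n with
  | zero => simp [cubeWt, cubeOp]
  | succ n ih =>
    simp [cubeWt, cubeOp_succ, evenPart_single, oddPart_single, ih, cubeWt_single_zero]

lemma exists_cubeWt_add_cubeWt_cubeOp_eq (n : ℕ) :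
    ∃ x, cubeWt n x + cubeWt n (cubeOp n x) = if Even n then n + 2 else n + 1 := by
  split_ifs with hn
  · refine ⟨Pi.single 0 1, ?_⟩
    rw [cubeWt_single_zero, cubeWt_cubeOp_single_zero]
    ring
  · refine ⟨cubeOp n (Pi.single 0 1), ?_⟩
    have hn0 : (n : ZMod 2) + 1 = 0 := by
      have := (ZMod.natCast_eq_zero_iff_even).2 (Nat.not_even_iff_odd.1 hn).add_one
      simpa using this
    rw [cubeOp_cubeOp, hn0, zero_smul, cubeWt_zero_right, cubeWt_cubeOp_single_zero, add_zero]

lemma hamWt_eq_zero_iff {n : ℕ} (v : Fin n → ZMod 2) : hamWt v = 0 ↔ v = 0 := by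
  simp [hamWt, Finset.filter_eq_empty_iff, funext_iff]

/-- For every `L ≥ 1` (paper index, `Hmat (L-1)` is the paper's `H_L`),
the minimum Hamming weight of a nonzero vector in the GF(2) row space of `H_L`
equals `L + 1` if `L` is odd and `L` if `L` is even. -/
theorem min_weight_row_space (L : ℕ) (hL : 1 ≤ L) :
    IsLeast {w : ℕ | ∃ v : Fin (2 ^ (L - 1 + 1)) → ZMod 2,
        v ∈ Submodule.span (ZMod 2) (Set.range (Hmat (L - 1))) ∧ v ≠ 0 ∧ w = hamWt v}
      (if Odd L then L + 1 else L) := by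
  obtain ⟨n, rfl⟩ : ∃ n, L = n + 1 := ⟨L - 1, by omega⟩
  have hmin : (if Odd (n + 1) then n + 1 + 1 else n + 1) = if Even n then n + 2 else n + 1 := by
    simp only [Nat.odd_add_one, Nat.not_odd_iff_even]
  rw [hmin]
  have hwt (x : ℕ → ZMod 2) : hamWt (fun c : Fin (2 ^ (n + 1)) => codeword n x c) =
      cubeWt n x + cubeWt n (cubeOp n x) := by
    rw [hamWt_eq_cubeWt, cubeWt_codeword]
  constructor
  · obtain ⟨x, hx⟩ := exists_cubeWt_add_cubeWt_cubeOp_eq n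
    refine ⟨fun c => codeword n x c, (mem_span_Hmat_iff n _).2 ⟨x, rfl⟩, ?_, ?_⟩
    · intro h0
      have h := (hamWt_eq_zero_iff _).2 h0
      have h' := hwt x
      rw [hx] at h'
      have : 0 < if Even n then n + 2 else n + 1 := by split_ifs <;> omega
      exact this.ne' (h'.symm.trans h)
    · exact ((hwt x).trans hx).symm
  · rintro w ⟨v, hv, hv0, rfl⟩
    obtain ⟨x, rfl⟩ := (mem_span_Hmat_iff n v).1 hv
    refine (add_one_le_cubeWt_add_cubeWt_cubeOp n x fun h0 => hv0 ?_).trans (hwt x).ge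
    refine (hamWt_eq_zero_iff _).1 ((hwt x).trans ?_)
    rw [h0, cubeWt_cubeOp_eq_zero h0]
end

section
/- For every L ≥ 1 and every row index i ∈ {1,…,2^{L−1}}, the minimum, over all subsets T of {1,…,2^{L−1}} containing i, of the Hamming weight wt(∑_{j∈T} row_j(H_L)) (the sum taken over GF(2)) equals L + 1 if L is odd, and equals L if L is even (with L ≥ 2 in the even case). -/
/-- The index `2j` of the doubled range. -/
def evenIdx {n : ℕ} (j : Fin (2 ^ n)) : Fin (2 ^ (n + 1)) :=
  ⟨2 * j.val, by have h := j.isLt; rw [pow_succ]; omega⟩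

/-- The index `2j + 1` of the doubled range. -/
def oddIdx {n : ℕ} (j : Fin (2 ^ n)) : Fin (2 ^ (n + 1)) :=
  ⟨2 * j.val + 1, by have h := j.isLt; rw [pow_succ]; omega⟩

theorem evenIdx_or_oddIdx {n : ℕ} (c : Fin (2 ^ (n + 1))) :
    (∃ j : Fin (2 ^ n), c = evenIdx j) ∨ ∃ j : Fin (2 ^ n), c = oddIdx j := by
  have hc : c.val < 2 ^ n * 2 := by simpa only [pow_succ] using c.isLt
  rcases Nat.mod_two_eq_zero_or_one c.val with h | h
  · exact Or.inl ⟨⟨c.val / 2, by omega⟩, Fin.ext (by simp only [evenIdx]; omega)⟩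
  · exact Or.inr ⟨⟨c.val / 2, by omega⟩, Fin.ext (by simp only [oddIdx]; omega)⟩

theorem evenIdx_injective {n : ℕ} : Function.Injective (evenIdx (n := n)) := fun i j h => by
  simp only [evenIdx, Fin.mk.injEq] at h
  exact Fin.ext (by omega)

theorem oddIdx_injective {n : ℕ} : Function.Injective (oddIdx (n := n)) := fun i j h => by
  simp only [oddIdx, Fin.mk.injEq] at h
  exact Fin.ext (by omega)

theorem evenIdx_ne_oddIdx {n : ℕ} (i j : Fin (2 ^ n)) : evenIdx i ≠ oddIdx j := fun h => by
  simp only [evenIdx, oddIdx, Fin.mk.injEq] at h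
  omega

theorem sum_even_add_sum_odd {M : Type*} [AddCommMonoid M] {n : ℕ} (f : Fin (2 ^ (n + 1)) → M) :
    ∑ c, f c = ∑ j, f (evenIdx j) + ∑ j, f (oddIdx j) := by
  rw [show ∑ j, f (evenIdx j) + ∑ j, f (oddIdx j) = ∑ s, f (Sum.elim evenIdx oddIdx s) from
    (Fintype.sum_sum_type fun s => f (Sum.elim evenIdx oddIdx s)).symm]
  symm
  refine Fintype.sum_bijective (Sum.elim evenIdx oddIdx) ⟨?_, ?_⟩ _ _ ?_
  · exact evenIdx_injective.sumElim oddIdx_injective evenIdx_ne_oddIdx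
  · intro c
    rcases evenIdx_or_oddIdx c with ⟨j, rfl⟩ | ⟨j, rfl⟩
    · exact ⟨Sum.inl j, rfl⟩
    · exact ⟨Sum.inr j, rfl⟩
  · exact fun _ => rfl

theorem funext_even_odd {α : Type*} {n : ℕ} {x y : Fin (2 ^ (n + 1)) → α}
    (he : x ∘ evenIdx = y ∘ evenIdx) (ho : x ∘ oddIdx = y ∘ oddIdx) : x = y := by
  funext c
  rcases evenIdx_or_oddIdx c with ⟨j, rfl⟩ | ⟨j, rfl⟩
  · exact congrFun he j
  · exact congrFun ho j

theorem hamWt_even_add_odd {n : ℕ} (x : Fin (2 ^ (n + 1)) → ZMod 2) :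
    hamWt x = hamWt (x ∘ evenIdx) + hamWt (x ∘ oddIdx) := by
  simp only [hamWt, Finset.card_filter, Function.comp_apply]
  exact sum_even_add_sum_odd _

theorem hamWt_zero {n : ℕ} : hamWt (0 : Fin n → ZMod 2) = 0 := by
  simp [hamWt]

theorem hamWt_pos {n : ℕ} {x : Fin n → ZMod 2} (hx : x ≠ 0) : 0 < hamWt x := by
  obtain ⟨c, hc⟩ := Function.ne_iff.mp hx
  exact Finset.card_pos.mpr ⟨c, by simpa using hc⟩

theorem hamWt_le_add {n : ℕ} (x y : Fin n → ZMod 2) : hamWt x ≤ hamWt (x + y) + hamWt y := by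
  refine le_trans (Finset.card_le_card ?_) (Finset.card_union_le _ _)
  intro c
  simp only [Finset.mem_filter, Finset.mem_univ, true_and, Finset.mem_union, Pi.add_apply]
  intro hx
  by_contra! h
  exact hx (by simpa [h.2] using h.1)

theorem hamWt_single {n : ℕ} (i : Fin n) : hamWt (Pi.single i (1 : ZMod 2)) = 1 := by
  simp [hamWt, Pi.single_apply, Finset.filter_eq']

theorem pairSwap_evenIdx {n : ℕ} (j : Fin (2 ^ n)) : pairSwap n (evenIdx j) = oddIdx j := by
  simp [pairSwap, evenIdx, oddIdx]

theorem pairSwap_oddIdx {n : ℕ} (j : Fin (2 ^ n)) : pairSwap n (oddIdx j) = evenIdx j := by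
  simp [pairSwap, evenIdx, oddIdx, Nat.add_mod]

theorem Hmat_oddIdx (n : ℕ) (r c : Fin (2 ^ n)) :
    Hmat n r (oddIdx c) = if r = c then 1 else 0 := by
  cases n with
  | zero =>
    have h : r = c := by ext; have := r.isLt; have := c.isLt; omega
    simp [Hmat, h]
  | succ n =>
    simp [Hmat, oddIdx, Nat.add_mod, Fin.ext_iff, eq_comm]

theorem Hmat_succ_even_even (n : ℕ) (r : Fin (2 ^ n)) (c : Fin (2 ^ (n + 1))) :
    Hmat (n + 1) (evenIdx r) (evenIdx c) = Hmat n r c := by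
  simp [Hmat, evenIdx]

theorem Hmat_succ_odd_even (n : ℕ) (r : Fin (2 ^ n)) (c : Fin (2 ^ (n + 1))) :
    Hmat (n + 1) (oddIdx r) (evenIdx c) = Hmat n r (pairSwap n c) := by
  have h : (2 * r.val + 1) / 2 = r.val := by omega
  simp [Hmat, evenIdx, oddIdx, Nat.add_mod, h]

/-- The combination of the rows of `Hmat n` with coefficients `x`, restricted to the columns
with even 0-indexed label. -/
def evenCols (n : ℕ) (x : Fin (2 ^ n) → ZMod 2) (c : Fin (2 ^ n)) : ZMod 2 :=
  ∑ r, x r * Hmat n r (evenIdx c)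

theorem hamWt_rowCombination (n : ℕ) (x : Fin (2 ^ n) → ZMod 2) :
    hamWt (fun c => ∑ r, x r * Hmat n r c) = hamWt (evenCols n x) + hamWt x := by
  rw [hamWt_even_add_odd]
  congr 2
  funext c
  simp [Hmat_oddIdx]

theorem evenCols_zero_level (x : Fin (2 ^ 0) → ZMod 2) : evenCols 0 x = x := by
  funext c
  have h : c = 0 := by ext; have := c.isLt; omega
  subst h
  simp [evenCols, Hmat]

theorem evenCols_succ_even (n : ℕ) (x : Fin (2 ^ (n + 1)) → ZMod 2) :
    evenCols (n + 1) x ∘ evenIdx = evenCols n (x ∘ evenIdx) + x ∘ oddIdx := by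
  funext c
  simp [evenCols, sum_even_add_sum_odd, Hmat_succ_even_even, Hmat_succ_odd_even,
    pairSwap_evenIdx, Hmat_oddIdx]

theorem evenCols_succ_odd (n : ℕ) (x : Fin (2 ^ (n + 1)) → ZMod 2) :
    evenCols (n + 1) x ∘ oddIdx = evenCols n (x ∘ oddIdx) + x ∘ evenIdx := by
  funext c
  simp [evenCols, sum_even_add_sum_odd, Hmat_succ_even_even, Hmat_succ_odd_even,
    pairSwap_oddIdx, Hmat_oddIdx, add_comm]

theorem evenCols_add (n : ℕ) (x y : Fin (2 ^ n) → ZMod 2) :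
    evenCols n (x + y) = evenCols n x + evenCols n y := by
  funext c
  simp [evenCols, add_mul, Finset.sum_add_distrib]

theorem evenCols_zero (n : ℕ) : evenCols n 0 = 0 := by
  funext c
  simp [evenCols]

theorem evenCols_evenCols (n : ℕ) (x : Fin (2 ^ n) → ZMod 2) :
    evenCols n (evenCols n x) = if Even n then x else 0 := by
  induction n with
  | zero => simp [evenCols_zero_level]
  | succ n ih =>
    have key (a b : Fin (2 ^ n) → ZMod 2) :
        evenCols n (evenCols n a + b) + (evenCols n b + a) = if Even (n + 1) then a else 0 := by
      rw [evenCols_add, ih]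
      have h2 (y : Fin (2 ^ n) → ZMod 2) : y + y = 0 := CharTwo.add_self_eq_zero y
      by_cases hn : Even n
      · simp only [Nat.even_add_one, hn, if_true, not_true, if_false]
        rw [show a + evenCols n b + (evenCols n b + a)
          = (a + a) + (evenCols n b + evenCols n b) by abel, h2, h2, add_zero]
      · simp only [Nat.even_add_one, hn, if_false, not_false_eq_true, if_true, zero_add]
        rw [← add_assoc, h2, zero_add]
    apply funext_even_odd
    · rw [evenCols_succ_even, evenCols_succ_even, evenCols_succ_odd, key]
      split_ifs <;> rfl
    · rw [evenCols_succ_odd, evenCols_succ_odd, evenCols_succ_even, key]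
      split_ifs <;> rfl

theorem le_hamWt_evenCols (n : ℕ) (x : Fin (2 ^ n) → ZMod 2) :
    (hamWt x : ℤ) * (n + 3 - 2 * hamWt x) ≤ hamWt (evenCols n x) := by
  induction n with
  | zero =>
    rw [evenCols_zero_level]
    push_cast
    rcases Nat.eq_zero_or_pos (hamWt x) with h | h
    · simp [h]
    · have : (1 : ℤ) ≤ hamWt x := by exact_mod_cast h
      nlinarith
  | succ n ih =>
    rw [hamWt_even_add_odd x, hamWt_even_add_odd (evenCols (n + 1) x), evenCols_succ_even,
      evenCols_succ_odd]
    generalize x ∘ evenIdx = a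
    generalize x ∘ oddIdx = b
    have ha := ih a
    have hb := ih b
    by_cases ha0 : a = 0
    · subst ha0
      simp only [evenCols_zero, zero_add, hamWt_zero, add_zero]
      push_cast
      linarith
    by_cases hb0 : b = 0
    · subst hb0
      simp only [evenCols_zero, zero_add, hamWt_zero, add_zero]
      push_cast
      linarith
    have hp : (1 : ℤ) ≤ hamWt a := by exact_mod_cast hamWt_pos ha0
    have hq : (1 : ℤ) ≤ hamWt b := by exact_mod_cast hamWt_pos hb0
    have h1 : (hamWt (evenCols n a) : ℤ) ≤ hamWt (evenCols n a + b) + hamWt b := by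
      exact_mod_cast hamWt_le_add _ _
    have h2 : (hamWt (evenCols n b) : ℤ) ≤ hamWt (evenCols n b + a) + hamWt a := by
      exact_mod_cast hamWt_le_add _ _
    push_cast
    nlinarith [mul_nonneg (sub_nonneg.mpr hp) (by linarith : (0 : ℤ) ≤ hamWt b),
      mul_nonneg (sub_nonneg.mpr hq) (by linarith : (0 : ℤ) ≤ hamWt a)]

theorem le_hamWt_add_of_even {n : ℕ} (hn : Even n) {x : Fin (2 ^ n) → ZMod 2} (hx : x ≠ 0) :
    n + 2 ≤ hamWt (evenCols n x) + hamWt x := by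
  have hinv : evenCols n (evenCols n x) = x := by rw [evenCols_evenCols, if_pos hn]
  have hy : evenCols n x ≠ 0 := fun h => hx (by rw [← hinv, h, evenCols_zero])
  have h1 := le_hamWt_evenCols n x
  have h2 := le_hamWt_evenCols n (evenCols n x)
  rw [hinv] at h2
  have hp : (1 : ℤ) ≤ hamWt x := by exact_mod_cast hamWt_pos hx
  have hq : (1 : ℤ) ≤ hamWt (evenCols n x) := by exact_mod_cast hamWt_pos hy
  zify
  by_contra! hlt
  rcases le_total (hamWt x : ℤ) (hamWt (evenCols n x)) with h | h
  · nlinarith [mul_nonneg (sub_nonneg.mpr hp)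
      (by linarith : (0 : ℤ) ≤ n + 2 - 2 * hamWt x)]
  · nlinarith [mul_nonneg (sub_nonneg.mpr hq)
      (by linarith : (0 : ℤ) ≤ n + 2 - 2 * hamWt (evenCols n x))]

theorem le_hamWt_add_of_odd {n : ℕ} (hn : Odd n) {x : Fin (2 ^ n) → ZMod 2} (hx : x ≠ 0) :
    n + 1 ≤ hamWt (evenCols n x) + hamWt x := by
  obtain ⟨m, rfl⟩ : ∃ m, n = m + 1 := ⟨n - 1, by have := hn.pos; omega⟩
  have hm : Even m := by simpa [Nat.odd_add_one] using hn
  rw [hamWt_even_add_odd x, hamWt_even_add_odd (evenCols (m + 1) x), evenCols_succ_even,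
    evenCols_succ_odd]
  have hab : x ∘ evenIdx ≠ 0 ∨ x ∘ oddIdx ≠ 0 := by
    by_contra! h
    exact hx (funext_even_odd h.1 h.2)
  generalize x ∘ evenIdx = a at *
  generalize x ∘ oddIdx = b at *
  have h1 := hamWt_le_add (evenCols m a) b
  have h2 := hamWt_le_add (evenCols m b) a
  rcases hab with h | h
  · have := le_hamWt_add_of_even hm h
    omega
  · have := le_hamWt_add_of_even hm h
    omega

theorem single_comp_same {α β : Type*} [DecidableEq α] [DecidableEq β] {f : α → β}
    (hf : Function.Injective f) (i : α) :
    (Pi.single (f i) 1 : β → ZMod 2) ∘ f = Pi.single i 1 := by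
  funext j
  simp [Pi.single_apply, hf.eq_iff]

theorem single_comp_of_ne {α β : Type*} [DecidableEq β] {f : α → β} {b : β}
    (h : ∀ a, f a ≠ b) : (Pi.single b 1 : β → ZMod 2) ∘ f = 0 := by
  funext j
  simp [h j]

theorem hamWt_evenCols_single (n : ℕ) (i : Fin (2 ^ n)) :
    hamWt (evenCols n (Pi.single i 1)) = n + 1 ∧ evenCols n (Pi.single i 1) i = 1 := by
  induction n with
  | zero => simp [evenCols_zero_level, hamWt_single]
  | succ n ih =>
    rw [hamWt_even_add_odd, evenCols_succ_even, evenCols_succ_odd]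
    rcases evenIdx_or_oddIdx i with ⟨j, rfl⟩ | ⟨j, rfl⟩
    · have he := single_comp_same evenIdx_injective j
      have ho : (Pi.single (evenIdx j) 1 : _ → ZMod 2) ∘ oddIdx = 0 :=
        single_comp_of_ne fun k => (evenIdx_ne_oddIdx j k).symm
      have hv := congrFun (evenCols_succ_even n (Pi.single (evenIdx j) 1)) j
      rw [Function.comp_apply] at hv
      rw [hv, he, ho]
      simp [evenCols_zero, hamWt_single, ih]
    · have ho := single_comp_same oddIdx_injective j
      have he : (Pi.single (oddIdx j) 1 : _ → ZMod 2) ∘ evenIdx = 0 :=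
        single_comp_of_ne fun k => evenIdx_ne_oddIdx k j
      have hv := congrFun (evenCols_succ_odd n (Pi.single (oddIdx j) 1)) j
      rw [Function.comp_apply] at hv
      rw [hv, he, ho]
      simp [evenCols_zero, hamWt_single, ih, add_comm]

theorem setOf_hamWt_eq (n : ℕ) (i : Fin (2 ^ n)) :
    {w : ℕ | ∃ T : Finset (Fin (2 ^ n)), i ∈ T ∧ w = hamWt (fun c => ∑ j ∈ T, Hmat n j c)} =
      {w : ℕ | ∃ x : Fin (2 ^ n) → ZMod 2, x i = 1 ∧ w = hamWt (evenCols n x) + hamWt x} := by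
  ext w
  constructor
  · rintro ⟨T, hi, rfl⟩
    refine ⟨fun j => if j ∈ T then 1 else 0, by simp [hi], ?_⟩
    rw [← hamWt_rowCombination]
    simp
  · rintro ⟨x, hi, rfl⟩
    refine ⟨Finset.univ.filter (fun j => x j = 1), by simp [hi], ?_⟩
    rw [← hamWt_rowCombination]
    congr 1
    funext c
    rw [Finset.sum_filter]
    refine Finset.sum_congr rfl fun j _ => ?_
    generalize x j = y
    generalize Hmat n j c = z
    revert y z
    decide

/-- For every `L ≥ 1` (paper index, `Hmat (L-1)` is the paper's `H_L`)
and every row index `i`, the minimum over subsets `T` of the row indices containing `i`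
of the Hamming weight of the GF(2) sum `∑_{j ∈ T} row_j(H_L)` equals `L + 1` if `L` is odd
and `L` if `L` is even. -/
theorem min_weight_stabilizer_containing (L : ℕ) (hL : 1 ≤ L) (i : Fin (2 ^ (L - 1))) :
    IsLeast {w : ℕ | ∃ T : Finset (Fin (2 ^ (L - 1))), i ∈ T ∧
        w = hamWt (fun c => ∑ j ∈ T, Hmat (L - 1) j c)}
      (if Odd L then L + 1 else L) := by
  obtain ⟨n, rfl⟩ : ∃ n, L = n + 1 := ⟨L - 1, by omega⟩
  change Fin (2 ^ n) at i
  change IsLeast {w : ℕ | ∃ T : Finset (Fin (2 ^ n)), i ∈ T ∧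
    w = hamWt (fun c => ∑ j ∈ T, Hmat n j c)} _
  rw [setOf_hamWt_eq]
  have hne {x : Fin (2 ^ n) → ZMod 2} (hx : x i = 1) : x ≠ 0 := by
    rintro rfl
    simp at hx
  obtain ⟨hwt, hi⟩ := hamWt_evenCols_single n i
  rcases Nat.even_or_odd n with hn | hn
  · rw [if_pos hn.add_one]
    refine ⟨⟨Pi.single i 1, by simp, by rw [hwt, hamWt_single]⟩, ?_⟩
    rintro w ⟨x, hx, rfl⟩
    exact le_hamWt_add_of_even hn (hne hx)
  · rw [if_neg (Nat.not_odd_iff_even.mpr hn.add_one)]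
    refine ⟨⟨evenCols n (Pi.single i 1), hi, ?_⟩, ?_⟩
    · rw [evenCols_evenCols, if_neg (Nat.not_even_iff_odd.mpr hn), hamWt_zero, hwt, zero_add]
    · rintro w ⟨x, hx, rfl⟩
      exact le_hamWt_add_of_odd hn (hne hx)
end

section
/- For every L ≥ 1, the quantity m(i) := min over subsets T of {1,…,2^{L−1}} with i ∈ T of the Hamming weight wt(∑_{j∈T} row_j(H_L)) (sum over GF(2)) does not depend on the row index i: m(i) = m(j) for all i, j ∈ {1,…,2^{L−1}}. -/
theorem pairSwap_val (M : ℕ) (c : Fin (2 ^ (M + 1))) : (pairSwap M c).val = c.val ^^^ 1 := by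
  have hdiv : (c.val ^^^ 1) / 2 = c.val / 2 := by simp [Nat.xor_div_two]
  have hmod := Nat.xor_mod_two_eq (m := c.val) (n := 1)
  unfold pairSwap
  split_ifs with h <;> simp only <;> omega

theorem div_two_lt_two_pow {n M : ℕ} (h : n < 2 ^ (M + 1)) : n / 2 < 2 ^ M := by
  rw [pow_succ] at h
  omega

theorem xor_mod_two_lt {n M : ℕ} (h : n < 2 ^ (M + 1)) (r : ℕ) :
    n ^^^ r % 2 < 2 ^ (M + 1) :=
  Nat.xor_lt_two_pow h ((Nat.mod_lt r two_pos).trans_le (Nat.le_self_pow (by omega) 2))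

theorem Hmat_succ (L r c : ℕ) (hr : r < 2 ^ (L + 1)) (hc : c < 2 ^ (L + 1 + 1)) :
    Hmat (L + 1) ⟨r, hr⟩ ⟨c, hc⟩ =
      if c % 2 = 1 then (if c = 2 * r + 1 then 1 else 0)
      else Hmat L ⟨r / 2, div_two_lt_two_pow hr⟩
        ⟨c / 2 ^^^ r % 2, xor_mod_two_lt (div_two_lt_two_pow hc) r⟩ := by
  simp only [Hmat, Matrix.of_apply]
  split_ifs with h₁ h₂ h₃
  · rfl
  · rfl
  · congr 1
    ext
    simp [pairSwap_val, h₃]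
  · congr 1
    ext
    simp [show r % 2 = 0 by omega]

/-- Translating the row index by `a` and the column index by `2 * a`, bitwise, fixes `Hmat L`. -/
theorem Hmat_xor (L : ℕ) : ∀ (r c a : ℕ) (hr : r < 2 ^ L) (hc : c < 2 ^ (L + 1))
    (hra : r ^^^ a < 2 ^ L) (hca : c ^^^ 2 * a < 2 ^ (L + 1)),
    Hmat L ⟨r ^^^ a, hra⟩ ⟨c ^^^ 2 * a, hca⟩ = Hmat L ⟨r, hr⟩ ⟨c, hc⟩ := by
  induction L with
  | zero => intros; rfl
  | succ L ih =>
    intro r c a hr hc hra hca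
    have hdiv : (c ^^^ 2 * a) / 2 = c / 2 ^^^ a := by simp [Nat.xor_div_two]
    have hmod : (c ^^^ 2 * a) % 2 = c % 2 := by
      rw [Nat.xor_mod_two_eq]
      omega
    have hbits : a ^^^ a % 2 = 2 * (a / 2) := by
      have h₁ : (a ^^^ a % 2) / 2 = a / 2 := by simp [Nat.xor_div_two]
      have h₂ := Nat.xor_mod_two_eq (m := a) (n := a % 2)
      omega
    have hrmod : (r ^^^ a) % 2 = r % 2 ^^^ a % 2 := by
      simpa using Nat.xor_mod_two_pow (a := r) (b := a) (n := 1)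
    rw [Hmat_succ, Hmat_succ]
    simp only [hmod]
    split_ifs with h₁ h₂ h₃ h₃
    · rfl
    · exact absurd (Nat.xor_left_inj.1 (show c / 2 ^^^ a = r ^^^ a by omega)) (by omega)
    · have : c / 2 = r := by omega
      rw [this] at hdiv
      omega
    · rfl
    · have hcol : (c ^^^ 2 * a) / 2 ^^^ (r ^^^ a) % 2 = (c / 2 ^^^ r % 2) ^^^ 2 * (a / 2) := by
        rw [hdiv, hrmod, ← hbits]
        ac_rfl
      have hrow : (r ^^^ a) / 2 = r / 2 ^^^ a / 2 := Nat.xor_div_two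
      simp only [hcol, hrow]
      apply ih

/-- Bitwise translation by `a`, as a permutation of `Fin (2 ^ M)`. -/
def xorPerm (M a : ℕ) (ha : a < 2 ^ M) : Equiv.Perm (Fin (2 ^ M)) :=
  Function.Involutive.toPerm (fun x => ⟨x.val ^^^ a, Nat.xor_lt_two_pow x.isLt ha⟩)
    fun x => by simp

theorem exists_perm_Hmat (L : ℕ) (i j : Fin (2 ^ L)) :
    ∃ (σ : Equiv.Perm (Fin (2 ^ L))) (τ : Equiv.Perm (Fin (2 ^ (L + 1)))),
      σ i = j ∧ ∀ r c, Hmat L (σ r) (τ c) = Hmat L r c := by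
  have ha : i.val ^^^ j.val < 2 ^ L := Nat.xor_lt_two_pow i.isLt j.isLt
  refine ⟨xorPerm L _ ha, xorPerm (L + 1) (2 * (i.val ^^^ j.val)) (by rw [pow_succ]; omega),
    ?_, fun r c => Hmat_xor L _ _ _ r.isLt c.isLt _ _⟩
  ext
  simp [xorPerm, ← Nat.xor_assoc]

theorem hamWt_comp_perm {n : ℕ} (τ : Equiv.Perm (Fin n)) (v : Fin n → ZMod 2) :
    hamWt (fun c => v (τ c)) = hamWt v :=
  Finset.card_equiv τ (by simp)

theorem row_weights_subset (L : ℕ) (i j : Fin (2 ^ L)) :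
    {w : ℕ | ∃ T : Finset (Fin (2 ^ L)), i ∈ T ∧ w = hamWt (fun c => ∑ k ∈ T, Hmat L k c)} ⊆
    {w : ℕ | ∃ T : Finset (Fin (2 ^ L)), j ∈ T ∧ w = hamWt (fun c => ∑ k ∈ T, Hmat L k c)} := by
  obtain ⟨σ, τ, rfl, h⟩ := exists_perm_Hmat L i j
  rintro w ⟨T, hT, rfl⟩
  refine ⟨T.map σ.toEmbedding, by simpa using hT, ?_⟩
  rw [← hamWt_comp_perm τ fun c => ∑ k ∈ T.map σ.toEmbedding, Hmat L k c]
  simp [h]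

/-- For every `L ≥ 1` (paper index, `Hmat (L-1)` is the paper's `H_L`),
the minimum `m(i)` over subsets `T` of the row indices with `i ∈ T` of the Hamming
weight of `∑_{j ∈ T} row_j(H_L)` does not depend on the row index `i`. -/
theorem min_weight_independent_of_row (L : ℕ) (hL : 1 ≤ L)
    (i j : Fin (2 ^ (L - 1))) :
    sInf {w : ℕ | ∃ T : Finset (Fin (2 ^ (L - 1))), i ∈ T ∧
        w = hamWt (fun c => ∑ k ∈ T, Hmat (L - 1) k c)} =
    sInf {w : ℕ | ∃ T : Finset (Fin (2 ^ (L - 1))), j ∈ T ∧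
        w = hamWt (fun c => ∑ k ∈ T, Hmat (L - 1) k c)} := by
  exact congrArg sInf
    ((row_weights_subset (L - 1) i j).antisymm (row_weights_subset (L - 1) j i))
end

section
/- For every L ≥ 1, every row of H_L has Hamming weight exactly L + 1. Moreover, for L ≥ 2, each row i of H_L has exactly L ones among the odd-indexed columns and exactly one 1 among the even-indexed columns, located in column 2i. -/
theorem pairSwap_involutive (M : ℕ) : Function.Involutive (pairSwap M) := by
  intro c
  apply Fin.ext
  unfold pairSwap
  split_ifs with h₁ h₂ h₂ <;> simp only at h₂ ⊢ <;> omega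

theorem hamWt_comp_equiv {m n : ℕ} (e : Fin m ≃ Fin n) (v : Fin n → ZMod 2) :
    hamWt (fun c => v (e c)) = hamWt v :=
  Finset.card_equiv e (by simp)

theorem card_filter_even_eq_hamWt {m n : ℕ} (h : m = 2 * n) (v : Fin n → ZMod 2)
    (w : Fin m → ZMod 2)
    (hw : ∀ c : Fin m, c.val % 2 = 0 → w c = v ⟨c.val / 2, by omega⟩) :
    (Finset.univ.filter (fun c : Fin m => c.val % 2 = 0 ∧ w c ≠ 0)).card = hamWt v := by
  refine Finset.card_bij' (fun c _ => ⟨c.val / 2, by omega⟩) (fun k _ => ⟨2 * k.val, by omega⟩)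
    ?_ ?_ ?_ ?_
  · intro c hc
    obtain ⟨hc₀, hc₁⟩ := (Finset.mem_filter.mp hc).2
    simpa [hw c hc₀] using hc₁
  · intro k hk
    have hk₁ := (Finset.mem_filter.mp hk).2
    simpa [hw ⟨2 * k.val, by omega⟩ (by simp)] using hk₁
  · intro c hc
    have hc₀ := (Finset.mem_filter.mp hc).2.1
    apply Fin.ext
    dsimp only
    omega
  · intro k _
    apply Fin.ext
    dsimp only
    omega

theorem hamWt_eq_card_even_add_card_odd {n : ℕ} (v : Fin n → ZMod 2) :
    hamWt v = (Finset.univ.filter (fun c : Fin n => c.val % 2 = 0 ∧ v c ≠ 0)).card +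
      (Finset.univ.filter (fun c : Fin n => c.val % 2 = 1 ∧ v c ≠ 0)).card := by
  rw [hamWt, ← Finset.card_filter_add_card_filter_not (fun c : Fin n => c.val % 2 = 0),
    Finset.filter_filter, Finset.filter_filter]
  simp only [and_comm, Nat.mod_two_ne_zero]

theorem Hmat_succ_odd_ne_zero_iff (L : ℕ) (i : Fin (2 ^ (L + 1))) (c : Fin (2 ^ (L + 1 + 1)))
    (hc : c.val % 2 = 1) : Hmat (L + 1) i c ≠ 0 ↔ c.val = 2 * i.val + 1 := by
  simp [Hmat, hc]

theorem card_filter_odd_Hmat_succ (L : ℕ) (i : Fin (2 ^ (L + 1))) :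
    (Finset.univ.filter (fun c : Fin (2 ^ (L + 1 + 1)) =>
      c.val % 2 = 1 ∧ Hmat (L + 1) i c ≠ 0)).card = 1 := by
  have hi : 2 * i.val + 1 < 2 ^ (L + 1 + 1) := by
    have := i.isLt
    rw [pow_succ 2 (L + 1)]
    omega
  refine Finset.card_eq_one.mpr ⟨⟨2 * i.val + 1, hi⟩, ?_⟩
  ext c
  simp only [Finset.mem_filter, Finset.mem_univ, true_and, Finset.mem_singleton, Fin.ext_iff]
  constructor
  · rintro ⟨hc, hne⟩
    exact (Hmat_succ_odd_ne_zero_iff L i c hc).mp hne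
  · intro hc
    have hodd : c.val % 2 = 1 := by omega
    exact ⟨hodd, (Hmat_succ_odd_ne_zero_iff L i c hodd).mpr hc⟩

theorem card_filter_even_Hmat_succ (L : ℕ) (i : Fin (2 ^ (L + 1))) :
    (Finset.univ.filter (fun c : Fin (2 ^ (L + 1 + 1)) =>
      c.val % 2 = 0 ∧ Hmat (L + 1) i c ≠ 0)).card =
      hamWt (Hmat L ⟨i.val / 2, by have := i.isLt; have := pow_succ 2 L; omega⟩) := by
  by_cases hi : i.val % 2 = 1
  · rw [← hamWt_comp_equiv (pairSwap_involutive L).toPerm]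
    exact card_filter_even_eq_hamWt (by ring) _ _ fun c hc => by simp [Hmat, hc, hi]
  · exact card_filter_even_eq_hamWt (by ring) _ _ fun c hc => by simp [Hmat, hc, hi]

theorem hamWt_Hmat (L : ℕ) (i : Fin (2 ^ L)) : hamWt (Hmat L i) = L + 2 := by
  induction L with
  | zero => simp [hamWt, Hmat]
  | succ L ih =>
    rw [hamWt_eq_card_even_add_card_odd, card_filter_even_Hmat_succ, card_filter_odd_Hmat_succ, ih]

/-- For every `L ≥ 1` (paper index, `Hmat (L-1)` is the paper's `H_L`),
every row of `H_L` has Hamming weight exactly `L + 1`.  Moreover, for `L ≥ 2`, each row `i`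
has exactly `L` ones among the odd-indexed (paper) columns (0-indexed columns `c` with
`c.val % 2 = 0`) and exactly one 1 among the even-indexed (paper) columns, located in paper
column `2i` (0-indexed column `2 * i.val + 1`). -/
theorem row_weight (L : ℕ) (hL : 1 ≤ L) (i : Fin (2 ^ (L - 1))) :
    hamWt (Hmat (L - 1) i) = L + 1 ∧
    (2 ≤ L →
      ((Finset.univ.filter (fun c : Fin (2 ^ (L - 1 + 1)) =>
          c.val % 2 = 0 ∧ Hmat (L - 1) i c ≠ 0)).card = L ∧
       (Finset.univ.filter (fun c : Fin (2 ^ (L - 1 + 1)) =>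
          c.val % 2 = 1 ∧ Hmat (L - 1) i c ≠ 0)).card = 1 ∧
       ∀ c : Fin (2 ^ (L - 1 + 1)), c.val % 2 = 1 →
          (Hmat (L - 1) i c ≠ 0 ↔ c.val = 2 * i.val + 1))) := by
  obtain ⟨L, rfl⟩ := Nat.exists_eq_add_of_le' hL
  refine ⟨hamWt_Hmat L i, fun hL₂ => ?_⟩
  obtain ⟨L, rfl⟩ := Nat.exists_eq_add_of_le' (Nat.le_of_succ_le_succ hL₂)
  exact ⟨(card_filter_even_Hmat_succ L i).trans (hamWt_Hmat L _),
    card_filter_odd_Hmat_succ L i, Hmat_succ_odd_ne_zero_iff L i⟩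
end
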